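/- Let g ≥ 2 be an integer and let J ⊂ ℚ[c₁,c₂,z] be the ideal generated by z² + c₁z + c₂, R₁, R₂ and R₃. Then the quotient ring ℚ[c₁,c₂,z]/J is a 4-dimensional ℚ-vector space with basis given by the images of 1, c₁, z and c₁²; in particular, its graded pieces (for the grading with c₁, z in degree 1 and c₂ in degree 2) have dimensions 1, 2, 1 in degrees 0, 1, 2 and vanish in all degrees ≥ 3. (This is the algebraic content of the computation of the rational Chow ring of the moduli space of 1-pointed irreducible, nodal hyperelliptic curves of genus g, which has the form ℚ[ψ₁,δ]/(δψ₁ + aδ², ψ₁² + bδ², δ³) with δ² ≠ 0.) -/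

import Mathlib

/-- The polynomial ring `ℚ[c₁, c₂, z]`, with `c₁ = X 0`, `c₂ = X 1`, `z = X 2`. -/
abbrev PolyCCZ := MvPolynomial (Fin 3) ℚ

/-- The class `c₁`. -/
noncomputable def c₁ : PolyCCZ := MvPolynomial.X 0

/-- The class `c₂`. -/
noncomputable def c₂ : PolyCCZ := MvPolynomial.X 1

/-- The class `z`. -/
noncomputable def z : PolyCCZ := MvPolynomial.X 2

/-- `R₁ = (8g³+12g²+4g)c₁² − (8g³−8g)c₂`. -/
noncomputable def R₁ (g : ℤ) : PolyCCZ :=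
  ((8 * g ^ 3 + 12 * g ^ 2 + 4 * g : ℤ) : PolyCCZ) * c₁ ^ 2
    - ((8 * g ^ 3 - 8 * g : ℤ) : PolyCCZ) * c₂

/-- `R₂ = −(8g³+12g²+4g)c₁³ + (16g³+12g²−8g−4)c₁c₂`. -/
noncomputable def R₂ (g : ℤ) : PolyCCZ :=
  -((8 * g ^ 3 + 12 * g ^ 2 + 4 * g : ℤ) : PolyCCZ) * c₁ ^ 3
    + ((16 * g ^ 3 + 12 * g ^ 2 - 8 * g - 4 : ℤ) : PolyCCZ) * c₁ * c₂

/-- `R₃ = (4g²+6g+2)c₁z + (4g²+4g)c₂`, the class of the locus where the marked point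
is a node. -/
noncomputable def R₃ (g : ℤ) : PolyCCZ :=
  ((4 * g ^ 2 + 6 * g + 2 : ℤ) : PolyCCZ) * c₁ * z
    + ((4 * g ^ 2 + 4 * g : ℤ) : PolyCCZ) * c₂

/-- The ideal `J = (z² + c₁z + c₂, R₁, R₂, R₃)` of relations in the Chow ring of the
moduli space of 1-pointed irreducible, nodal hyperelliptic curves of genus `g`. -/
noncomputable def J (g : ℤ) : Ideal PolyCCZ :=
  Ideal.span {z ^ 2 + c₁ * z + c₂, R₁ g, R₂ g, R₃ g}

open MvPolynomial in
/-- The linear functional reading off the coefficient of `c₁ ^ 2` modulo the relations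
`c₂ = b c₁²`, `c₁ z = a c₁²`, `z² = -(a + b) c₁²`. -/
noncomputable def topFunctional (a b : ℚ) (p : PolyCCZ) : ℚ :=
  constantCoeff (pderiv 0 (pderiv 0 p)) / 2 + b * constantCoeff (pderiv 1 p)
    + a * constantCoeff (pderiv 0 (pderiv 2 p))
    - (a + b) / 2 * constantCoeff (pderiv 2 (pderiv 2 p))

theorem genus_factors_ne_zero {g : ℤ} (hg : 2 ≤ g) :
    (g : ℚ) ≠ 0 ∧ (g : ℚ) - 1 ≠ 0 ∧ (g : ℚ) + 1 ≠ 0 ∧ 2 * (g : ℚ) + 1 ≠ 0 ∧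
      2 * (g : ℚ) - 1 ≠ 0 := by
  have h : (2 : ℚ) ≤ g := by exact_mod_cast hg
  refine ⟨?_, ?_, ?_, ?_, ?_⟩ <;> intro h' <;> linarith

theorem quotient_smul_def {g : ℤ} (q : ℚ) (t : PolyCCZ ⧸ J g) :
    q • t = Ideal.Quotient.mk (J g) (MvPolynomial.C q) * t :=
  Algebra.smul_def q t

open MvPolynomial in
theorem functionals_eq_zero_of_mem_J {g : ℤ} {a b : ℚ}
    (hb : (8 * g ^ 3 + 12 * g ^ 2 + 4 * g : ℚ) = (8 * g ^ 3 - 8 * g) * b)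
    (ha : (4 * g ^ 2 + 6 * g + 2 : ℚ) * a + (4 * g ^ 2 + 4 * g) * b = 0)
    {p : PolyCCZ} (hp : p ∈ J g) :
    constantCoeff p = 0 ∧ constantCoeff (pderiv 0 p) = 0 ∧ constantCoeff (pderiv 2 p) = 0 ∧
      topFunctional a b p = 0 := by
  unfold J at hp
  induction hp using Submodule.span_induction with
  | mem p hp =>
    simp only [Set.mem_insert_iff, Set.mem_singleton_iff] at hp
    rcases hp with rfl | rfl | rfl | rfl
    · simp [topFunctional, c₁, c₂, z, pderiv_X]
      repeat rw [map_ofNat]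
      ring
    · simp [topFunctional, R₁, c₁, c₂, pderiv_X]
      repeat rw [map_ofNat]
      linear_combination hb
    · simp [topFunctional, R₂, c₁, c₂, pderiv_X]
    · simp [topFunctional, R₃, c₁, c₂, z, pderiv_X]
      repeat rw [map_ofNat]
      linear_combination ha
  | zero => simp [topFunctional]
  | add p q _ _ hp hq =>
    obtain ⟨hp0, hp1, hp2, hp3⟩ := hp
    obtain ⟨hq0, hq1, hq2, hq3⟩ := hq
    refine ⟨by simp [hp0, hq0], by simp [hp1, hq1], by simp [hp2, hq2], ?_⟩
    simp only [topFunctional, map_add] at hp3 hq3 ⊢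
    linear_combination hp3 + hq3
  | smul q p _ hp =>
    obtain ⟨hp0, hp1, hp2, hp3⟩ := hp
    refine ⟨by simp [hp0], by simp [hp0, hp1], by simp [hp0, hp2], ?_⟩
    simp only [topFunctional, smul_eq_mul, Derivation.leibniz, map_add, map_mul, hp0, hp1,
      hp2] at hp3 ⊢
    linear_combination constantCoeff q * hp3

open MvPolynomial in
theorem linearIndependent_mk {g : ℤ} (hg : 2 ≤ g) :
    LinearIndependent ℚ
      ![(1 : PolyCCZ ⧸ J g), Ideal.Quotient.mk (J g) c₁,
        Ideal.Quotient.mk (J g) z, Ideal.Quotient.mk (J g) (c₁ ^ 2)] := by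
  obtain ⟨h0, h1, h2, h3, -⟩ := genus_factors_ne_zero hg
  rw [Fintype.linearIndependent_iff]
  intro f hf
  have hmem : C (f 0) + C (f 1) * c₁ + C (f 2) * z + C (f 3) * c₁ ^ 2 ∈ J g := by
    rw [← Ideal.Quotient.eq_zero_iff_mem, ← hf]
    simp only [Fin.sum_univ_four, quotient_smul_def]
    simp
  have hb : (8 * g ^ 3 + 12 * g ^ 2 + 4 * g : ℚ)
      = (8 * g ^ 3 - 8 * g) * ((2 * g + 1) / (2 * (g - 1))) := by
    field_simp
    ring
  have ha : (4 * g ^ 2 + 6 * g + 2 : ℚ) * (-g / (g - 1))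
      + (4 * g ^ 2 + 4 * g) * ((2 * g + 1) / (2 * (g - 1))) = 0 := by
    field_simp
    ring
  obtain ⟨e0, e1, e2, e3⟩ := functionals_eq_zero_of_mem_J hb ha hmem
  simp [topFunctional, c₁, z, pderiv_X] at e0 e1 e2 e3
  rw [map_ofNat] at e3
  replace e3 := e3.resolve_right two_ne_zero
  intro i
  fin_cases i <;> assumption

/-- The relations in the quotient by `J g`, solved for multiples of `c₁²`. -/
theorem quotient_relations {g : ℤ} (hg : 2 ≤ g) :
    ∃ a b d : ℚ,
      Ideal.Quotient.mk (J g) c₂ = b • Ideal.Quotient.mk (J g) c₁ ^ 2 ∧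
      Ideal.Quotient.mk (J g) c₁ * Ideal.Quotient.mk (J g) z
        = a • Ideal.Quotient.mk (J g) c₁ ^ 2 ∧
      Ideal.Quotient.mk (J g) z ^ 2 = d • Ideal.Quotient.mk (J g) c₁ ^ 2 ∧
      Ideal.Quotient.mk (J g) c₁ ^ 3 = 0 := by
  obtain ⟨h0, h1, h2, h3, h4⟩ := genus_factors_ne_zero hg
  have rel {p : PolyCCZ} (hp : p ∈ ({z ^ 2 + c₁ * z + c₂, R₁ g, R₂ g, R₃ g} : Set PolyCCZ)) :
      Ideal.Quotient.mk (J g) p = 0 :=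
    Ideal.Quotient.eq_zero_iff_mem.2 (Ideal.subset_span hp)
  have e0 := rel (p := z ^ 2 + c₁ * z + c₂) (by simp)
  have e1 := rel (p := R₁ g) (by simp)
  have e2 := rel (p := R₂ g) (by simp)
  have e3 := rel (p := R₃ g) (by simp)
  simp only [R₁, R₂, R₃, map_add, map_sub, map_neg, map_mul, map_pow, map_intCast] at e0 e1 e2 e3
  generalize Ideal.Quotient.mk (J g) c₁ = x at *
  generalize Ideal.Quotient.mk (J g) c₂ = y at *
  generalize Ideal.Quotient.mk (J g) z = w at *
  have cancel {q : ℚ} (hq : q ≠ 0) {t : PolyCCZ ⧸ J g}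
      (h : algebraMap ℚ _ q * t = 0) : t = 0 := by
    rw [← Algebra.smul_def] at h
    exact (smul_eq_zero.1 h).resolve_left hq
  set b : ℚ := (2 * g + 1) / (2 * (g - 1)) with hbdef
  set a : ℚ := -g / (g - 1) with hadef
  have hb : (8 * g ^ 3 - 8 * g : ℚ) * b = 8 * g ^ 3 + 12 * g ^ 2 + 4 * g := by
    rw [hbdef]
    field_simp
    ring
  have ha : (4 * g ^ 2 + 6 * g + 2 : ℚ) * a + (4 * g ^ 2 + 4 * g) * b = 0 := by
    rw [hadef, hbdef]
    field_simp
    ring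
  have hbA := congrArg (algebraMap ℚ (PolyCCZ ⧸ J g)) hb
  have haA := congrArg (algebraMap ℚ (PolyCCZ ⧸ J g)) ha
  push_cast at e1 e2 e3
  simp only [map_add, map_sub, map_mul, map_pow, map_intCast, map_ofNat, map_zero] at hbA haA
  have hy : y = algebraMap ℚ _ b * x ^ 2 := by
    refine sub_eq_zero.1 (cancel (q := 8 * g ^ 3 - 8 * g) ?_ ?_)
    · rw [show (8 * g ^ 3 - 8 * g : ℚ) = 8 * (g * ((g - 1) * (g + 1))) by ring]
      positivity
    · simp only [map_sub, map_mul, map_pow, map_intCast, map_ofNat]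
      linear_combination -e1 - x ^ 2 * hbA
  have hw : x * w = algebraMap ℚ _ a * x ^ 2 := by
    refine sub_eq_zero.1 (cancel (q := 4 * g ^ 2 + 6 * g + 2) ?_ ?_)
    · rw [show (4 * g ^ 2 + 6 * g + 2 : ℚ) = 2 * ((2 * g + 1) * (g + 1)) by ring]
      positivity
    · simp only [map_add, map_mul, map_pow, map_intCast, map_ofNat]
      linear_combination e3 - x ^ 2 * haA - (4 * g ^ 2 + 4 * g) * hy
  have hx : x ^ 3 = 0 := by
    refine cancel (q := -(8 * g ^ 3 + 12 * g ^ 2 + 4 * g)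
      + (16 * g ^ 3 + 12 * g ^ 2 - 8 * g - 4) * b) ?_ ?_
    · rw [show -(8 * g ^ 3 + 12 * g ^ 2 + 4 * g) + (16 * g ^ 3 + 12 * g ^ 2 - 8 * g - 4) * b
        = 2 * (g + 1) ^ 2 * (2 * g + 1) * (2 * g - 1) / (g - 1) by
          rw [hbdef]
          field_simp
          ring]
      positivity
    · simp only [map_neg, map_add, map_sub, map_mul, map_pow, map_intCast, map_ofNat]
      linear_combination e2 - (16 * g ^ 3 + 12 * g ^ 2 - 8 * g - 4) * x * hy
  refine ⟨a, b, -(a + b), ?_, ?_, ?_, hx⟩ <;> rw [quotient_smul_def]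
  · exact hy
  · exact hw
  · change _ = algebraMap ℚ (PolyCCZ ⧸ J g) (-(a + b)) * _
    rw [map_neg, map_add]
    linear_combination e0 - hy - hw

theorem span_range_mk_eq_top {g : ℤ} (hg : 2 ≤ g) :
    Submodule.span ℚ
      (Set.range
        ![(1 : PolyCCZ ⧸ J g), Ideal.Quotient.mk (J g) c₁,
          Ideal.Quotient.mk (J g) z, Ideal.Quotient.mk (J g) (c₁ ^ 2)]) = ⊤ := by
  obtain ⟨a, b, d, hy, hw, hz, hx⟩ := quotient_relations hg
  set S := Submodule.span ℚ
      (Set.range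
        ![(1 : PolyCCZ ⧸ J g), Ideal.Quotient.mk (J g) c₁,
          Ideal.Quotient.mk (J g) z, Ideal.Quotient.mk (J g) (c₁ ^ 2)]) with hS
  have hmem (i) := Submodule.subset_span (R := ℚ) (Set.mem_range_self (f :=
    ![(1 : PolyCCZ ⧸ J g), Ideal.Quotient.mk (J g) c₁,
          Ideal.Quotient.mk (J g) z, Ideal.Quotient.mk (J g) (c₁ ^ 2)]) i)
  rw [← hS] at hmem
  have m0 : 1 ∈ S := hmem 0
  have m1 : Ideal.Quotient.mk (J g) c₁ ∈ S := hmem 1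
  have m2 : Ideal.Quotient.mk (J g) z ∈ S := hmem 2
  have m3 : Ideal.Quotient.mk (J g) c₁ ^ 2 ∈ S := by simpa using hmem 3
  have hmul (i : Fin 3) {t : PolyCCZ ⧸ J g} (ht : t ∈ S) :
      t * Ideal.Quotient.mk (J g) (MvPolynomial.X i) ∈ S := by
    have hX : Ideal.Quotient.mk (J g) (MvPolynomial.X i) = Ideal.Quotient.mk (J g) c₁ ∨
        Ideal.Quotient.mk (J g) (MvPolynomial.X i) = Ideal.Quotient.mk (J g) c₂ ∨
        Ideal.Quotient.mk (J g) (MvPolynomial.X i) = Ideal.Quotient.mk (J g) z := by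
      fin_cases i
      exacts [.inl rfl, .inr (.inl rfl), .inr (.inr rfl)]
    generalize Ideal.Quotient.mk (J g) (MvPolynomial.X i) = u at hX ⊢
    rw [hS] at ht
    induction ht using Submodule.span_induction with
    | zero => simp
    | add s t _ _ hs ht => rw [add_mul]; exact S.add_mem hs ht
    | smul q t _ ht => rw [smul_mul_assoc]; exact S.smul_mem q ht
    | mem t ht =>
      obtain ⟨j, rfl⟩ := ht
      rw [hy] at hX
      have hsmul (q : ℚ) (s t : PolyCCZ ⧸ J g) : s * q • t = q • (s * t) := by
        rw [quotient_smul_def, quotient_smul_def, mul_left_comm]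
      clear_value S
      simp only [map_pow]
      generalize Ideal.Quotient.mk (J g) c₁ = x at *
      generalize Ideal.Quotient.mk (J g) z = w at *
      have hxx : x * x = x ^ 2 := by ring
      have hwx : w * x = a • x ^ 2 := by rw [mul_comm, hw]
      have hww : w * w = d • x ^ 2 := by rw [← sq, hz]
      have hx1 : x * x ^ 2 = 0 := by rw [← hx]; ring
      have hx2 : x ^ 2 * x = 0 := by rw [← hx]; ring
      have hx4 : x ^ 2 * x ^ 2 = 0 := by linear_combination x * hx
      have hxw : x ^ 2 * w = 0 := by
        rw [sq, mul_assoc, hw, hsmul, hx1, smul_zero]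
      have hwxx : w * x ^ 2 = 0 := by rw [mul_comm, hxw]
      rcases hX with rfl | rfl | rfl <;> fin_cases j <;>
        simp [hsmul, hxx, hwx, hww, hx1, hx2, hx4, hxw, hwxx, hw, m1, m2, m3, S.smul_mem]
  rw [eq_top_iff]
  rintro t -
  obtain ⟨p, rfl⟩ := Ideal.Quotient.mk_surjective t
  induction p using MvPolynomial.induction_on with
  | C q =>
    rw [← MvPolynomial.algebraMap_eq, Ideal.Quotient.mk_algebraMap, Algebra.algebraMap_eq_smul_one]
    exact S.smul_mem q m0
  | add p q hp hq => rw [map_add]; exact S.add_mem hp hq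
  | mul_X p i hp => rw [map_mul]; exact hmul i hp

/-- For `g ≥ 2`, the quotient `ℚ[c₁,c₂,z]/J` is a 4-dimensional `ℚ`-vector space with
basis given by the images of `1`, `c₁`, `z`, `c₁²`. -/
theorem chow_Igone (g : ℤ) (hg : 2 ≤ g) :
    LinearIndependent ℚ
        ![(1 : PolyCCZ ⧸ J g), Ideal.Quotient.mk (J g) c₁,
          Ideal.Quotient.mk (J g) z, Ideal.Quotient.mk (J g) (c₁ ^ 2)]
    ∧ Submodule.span ℚ
        (Set.range
          ![(1 : PolyCCZ ⧸ J g), Ideal.Quotient.mk (J g) c₁,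
            Ideal.Quotient.mk (J g) z, Ideal.Quotient.mk (J g) (c₁ ^ 2)]) = ⊤
    ∧ Module.finrank ℚ (PolyCCZ ⧸ J g) = 4 := by
  have hli := linearIndependent_mk hg
  have hspan := span_range_mk_eq_top hg
  refine ⟨hli, hspan, ?_⟩
  rw [← finrank_top, ← hspan, finrank_span_eq_card hli, Fintype.card_fin]
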